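/- With G, d, T, gᵢ and the notion of 3-word as in the context, the 𝔽₃-subspace of G spanned by all 3-words in which each of the letters g₀, g₁, g₂, g₃, g₄ occurs exactly once and each of the letters g₅, g₆ occurs exactly twice has 𝔽₃-dimension 6. -/

import Mathlib

/-- The Grassmann (exterior) algebra over `𝔽₃` of the free module with basis
indexed by `ℕ × ℕ`. -/
abbrev Gr : Type := ExteriorAlgebra (ZMod 3) ((ℕ × ℕ) →₀ ZMod 3)

/-- The generator `i^{(j)}` of the Grassmann algebra, i.e. `ι(e_{i,j})`. -/
noncomputable abbrev gen (i j : ℕ) : Gr :=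
  ExteriorAlgebra.ι (ZMod 3) (Finsupp.single (i, j) (1 : ZMod 3))

/-- `gᵢ = ι(e_{i,0})`. -/
noncomputable abbrev g (i : ℕ) : Gr := gen i 0

/-- `IsWord3 g T x L` : `x` is a 3-word, for the ternary operation `T`, in the
multiset of letters `L` (a multiset of indices of the generators `g`). Each
`g i` is a 3-word in the singleton multiset `{i}`, and if `u, v, w` are 3-words
in `L₁, L₂, L₃` then `T u v w` is a 3-word in `L₁ + L₂ + L₃`. -/
inductive IsWord3 {G : Type*} (g : ℕ → G) (T : G → G → G → G) : G → Multiset ℕ → Prop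
  | letter (i : ℕ) : IsWord3 g T (g i) {i}
  | node {u v w : G} {L₁ L₂ L₃ : Multiset ℕ} :
      IsWord3 g T u L₁ → IsWord3 g T v L₂ → IsWord3 g T w L₃ →
      IsWord3 g T (T u v w) (L₁ + L₂ + L₃)

/-- Every linear endomorphism of a module extends to a derivation of its exterior algebra. -/
theorem ExteriorAlgebra.exists_derivation_extending {R M : Type*} [CommRing R] [AddCommGroup M]
    [Module R M] (f : M →ₗ[R] M) :
    ∃ e : ExteriorAlgebra R M →ₗ[R] ExteriorAlgebra R M,
      (∀ u v, e (u * v) = e u * v + u * e v) ∧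
      ∀ m, e (ExteriorAlgebra.ι R m) = ExteriorAlgebra.ι R (f m) := by
  let φ : M →ₗ[R] TrivSqZeroExt (ExteriorAlgebra R M) (ExteriorAlgebra R M) :=
    { toFun := fun m => .inl (ExteriorAlgebra.ι R m) + .inr (ExteriorAlgebra.ι R (f m))
      map_add' := fun x y => by ext <;> simp
      map_smul' := fun c x => by ext <;> simp }
  have fst_φ (m : M) : (φ m).fst = ExteriorAlgebra.ι R m := by simp [φ]
  have snd_φ (m : M) : (φ m).snd = ExteriorAlgebra.ι R (f m) := by simp [φ]
  have hφ (m : M) : φ m * φ m = 0 := by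
    ext
    · rw [TrivSqZeroExt.fst_mul, fst_φ, ExteriorAlgebra.ι_sq_zero, TrivSqZeroExt.fst_zero]
    · rw [TrivSqZeroExt.snd_mul, fst_φ, snd_φ, TrivSqZeroExt.snd_zero]
      exact ExteriorAlgebra.ι_add_mul_swap _ _
  let Φ := ExteriorAlgebra.lift R ⟨φ, hφ⟩
  have Φ_ι (m : M) : Φ (ExteriorAlgebra.ι R m) = φ m := ExteriorAlgebra.lift_ι_apply R φ hφ m
  have fst_Φ (x : ExteriorAlgebra R M) : (Φ x).fst = x := by
    have h : (TrivSqZeroExt.fstHom R _ _).comp Φ = AlgHom.id R (ExteriorAlgebra R M) := by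
      apply ExteriorAlgebra.hom_ext
      ext m
      exact (congrArg TrivSqZeroExt.fst (Φ_ι m)).trans (fst_φ m)
    exact DFunLike.congr_fun h x
  refine ⟨{ toFun := fun x => (Φ x).snd
            map_add' := fun x y => by rw [map_add, TrivSqZeroExt.snd_add]
            map_smul' := fun c x => by rw [map_smul, TrivSqZeroExt.snd_smul, RingHom.id_apply] },
    fun u v => ?_, fun m => ?_⟩
  · change (Φ (u * v)).snd = (Φ u).snd * v + u * (Φ v).snd
    rw [map_mul, TrivSqZeroExt.snd_mul, fst_Φ, fst_Φ, add_comm]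
    rfl
  · exact (congrArg TrivSqZeroExt.snd (Φ_ι m)).trans (snd_φ m)

/-- The product of the generators listed in `l`. -/
noncomputable def monomial (l : List (ℕ × ℕ)) : Gr := (l.map fun p => gen p.1 p.2).prod

theorem monomial_cons (p : ℕ × ℕ) (l : List (ℕ × ℕ)) :
    monomial (p :: l) = gen p.1 p.2 * monomial l := by
  simp [monomial]

theorem monomial_nil : monomial [] = 1 := rfl

theorem monomial_append (l l' : List (ℕ × ℕ)) :
    monomial (l ++ l') = monomial l * monomial l' := by
  simp [monomial]

theorem gen_mul_gen_self (i j : ℕ) : gen i j * gen i j = 0 := ExteriorAlgebra.ι_sq_zero _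

theorem gen_mul_gen_swap (i j k l : ℕ) : gen i j * gen k l = -(gen k l * gen i j) :=
  eq_neg_of_add_eq_zero_left (ExteriorAlgebra.ι_add_mul_swap _ _)

theorem gen_mul_gen_mul_self (i j : ℕ) (x : Gr) : gen i j * (gen i j * x) = 0 := by
  rw [← mul_assoc, gen_mul_gen_self, zero_mul]

theorem gen_mul_gen_mul_swap (i j k l : ℕ) (x : Gr) :
    gen i j * (gen k l * x) = -(gen k l * (gen i j * x)) := by
  rw [← mul_assoc, gen_mul_gen_swap, neg_mul, mul_assoc]

/-- Permuting the factors of a monomial changes it at most by a sign. -/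
theorem monomial_perm {l l' : List (ℕ × ℕ)} (h : l.Perm l') :
    monomial l = monomial l' ∨ monomial l = -monomial l' := by
  induction h with
  | nil => exact .inl rfl
  | cons p _ ih =>
    simp only [monomial_cons]
    rcases ih with h | h <;> simp [h]
  | swap p q l =>
    right
    simp only [monomial_cons]
    exact gen_mul_gen_mul_swap _ _ _ _ _
  | trans _ _ ih₁ ih₂ =>
    rcases ih₁ with h₁ | h₁ <;> rcases ih₂ with h₂ | h₂ <;> simp [h₁, h₂]

/-- Contraction with a linear form is an antiderivation of the exterior algebra. -/
theorem ExteriorAlgebra.exists_contraction {R M : Type*} [CommRing R] [AddCommGroup M]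
    [Module R M] (f : Module.Dual R M) :
    ∃ c : ExteriorAlgebra R M →ₗ[R] ExteriorAlgebra R M, c 1 = 0 ∧
      ∀ m x, c (ExteriorAlgebra.ι R m * x) = f m • x - ExteriorAlgebra.ι R m * c x :=
  ⟨CliffordAlgebra.contractLeft (Q := (0 : QuadraticForm R M)) f,
    CliffordAlgebra.contractLeft_one 0 f,
    fun m x => CliffordAlgebra.contractLeft_ι_mul (Q := (0 : QuadraticForm R M)) f m x⟩

theorem monomial_ne_zero {l : List (ℕ × ℕ)} (h : l.Nodup) : monomial l ≠ 0 := by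
  induction l with
  | nil => exact one_ne_zero
  | cons p l ih =>
    rw [List.nodup_cons] at h
    intro h0
    apply ih h.2
    obtain ⟨c, hc1, hc⟩ := ExteriorAlgebra.exists_contraction
      (Finsupp.lapply p : ((ℕ × ℕ) →₀ ZMod 3) →ₗ[ZMod 3] ZMod 3)
    have hcl (l : List (ℕ × ℕ)) (hl : p ∉ l) : c (monomial l) = 0 := by
      induction l with
      | nil => exact hc1
      | cons q l ih =>
        simp only [List.mem_cons, not_or] at hl
        rw [monomial_cons, hc, ih hl.2, mul_zero, sub_zero, Finsupp.lapply_apply,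
          Finsupp.single_eq_of_ne hl.1, zero_smul]
    have key := hc (Finsupp.single p 1) (monomial l)
    rw [hcl l h.1, mul_zero, sub_zero, Finsupp.lapply_apply, Finsupp.single_eq_same, one_smul]
      at key
    rw [← key, ← map_zero c]
    exact congrArg c ((monomial_cons p l).symm.trans h0)

/-- The span of the monomials with letters `L` and total number of derivatives `w`. -/
noncomputable def homogeneous (L : Multiset ℕ) (w : ℕ) : Submodule (ZMod 3) Gr :=
  Submodule.span (ZMod 3)
    {x | ∃ l : List (ℕ × ℕ), ((l.map Prod.fst : List ℕ) : Multiset ℕ) = L ∧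
      (l.map Prod.snd).sum = w ∧ monomial l = x}

theorem monomial_mem_homogeneous (l : List (ℕ × ℕ)) :
    monomial l ∈ homogeneous (l.map Prod.fst : List ℕ) (l.map Prod.snd).sum :=
  Submodule.subset_span ⟨l, rfl, rfl, rfl⟩

theorem gen_mem_homogeneous (i j : ℕ) : gen i j ∈ homogeneous {i} j := by
  simpa [monomial] using monomial_mem_homogeneous [(i, j)]

theorem mul_mem_homogeneous {L L' : Multiset ℕ} {w w' : ℕ} {x y : Gr}
    (hx : x ∈ homogeneous L w) (hy : y ∈ homogeneous L' w') :
    x * y ∈ homogeneous (L + L') (w + w') := by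
  refine Submodule.mul_le.1 (?_ : homogeneous L w * homogeneous L' w' ≤ _) x hx y hy
  rw [homogeneous, homogeneous, Submodule.span_mul_span, Submodule.span_le]
  rintro _ ⟨_, ⟨l, rfl, rfl, rfl⟩, _, ⟨l', rfl, rfl, rfl⟩, rfl⟩
  simpa [monomial_append] using monomial_mem_homogeneous (l ++ l')

section Derivation

variable {d : Gr →ₗ[ZMod 3] Gr}

theorem map_one_eq_zero_of_leibniz (hLeib : ∀ u v : Gr, d (u * v) = d u * v + u * d v) :
    d 1 = 0 := by
  simpa using hLeib 1 1

theorem map_mem_homogeneous (hLeib : ∀ u v : Gr, d (u * v) = d u * v + u * d v)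
    (hd : ∀ i j : ℕ, d (gen i j) = gen i (j + 1)) {L : Multiset ℕ} {w : ℕ} {x : Gr}
    (hx : x ∈ homogeneous L w) : d x ∈ homogeneous L (w + 1) := by
  refine (Submodule.span_le.2 ?_ : homogeneous L w ≤ (homogeneous L (w + 1)).comap d) hx
  rintro _ ⟨l, rfl, rfl, rfl⟩
  clear hx
  rw [SetLike.mem_coe, Submodule.mem_comap]
  induction l with
  | nil =>
    rw [monomial_nil, map_one_eq_zero_of_leibniz hLeib]
    exact zero_mem _
  | cons p l ih =>
    rw [monomial_cons, hLeib, hd]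
    refine add_mem ?_ ?_
    · convert mul_mem_homogeneous (gen_mem_homogeneous p.1 (p.2 + 1))
        (monomial_mem_homogeneous l) using 2
      · simp
      · simp only [List.map_cons, List.sum_cons]
        ring
    · convert mul_mem_homogeneous (gen_mem_homogeneous p.1 p.2) ih using 2
      · simp
      · simp only [List.map_cons, List.sum_cons]
        ring

/-- A derivation lowering the order of the generators with the indicated coefficients commutes
with `d` on homogeneous elements up to a scalar. -/
theorem lowering_comm {e : Gr →ₗ[ZMod 3] Gr} (heLeib : ∀ u v : Gr, e (u * v) = e u * v + u * e v)
    (he : ∀ i j : ℕ, e (gen i j) = ((j : ZMod 3) * (j + 1)) • gen i (j - 1))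
    (hLeib : ∀ u v : Gr, d (u * v) = d u * v + u * d v)
    (hd : ∀ i j : ℕ, d (gen i j) = gen i (j + 1)) {L : Multiset ℕ} {w : ℕ} {x : Gr}
    (hx : x ∈ homogeneous L w) :
    e (d x) = d (e x) + (2 * w - L.card : ZMod 3) • x := by
  have h3 : (3 : ZMod 3) = 0 := by decide
  have hgen (i j : ℕ) : e (d (gen i j)) = d (e (gen i j)) + (2 * j - 1 : ZMod 3) • gen i j := by
    rw [hd, he, he, map_smul, hd]
    rcases j with _ | j
    · simp only [Nat.cast_zero, zero_mul, zero_smul, zero_add, Nat.sub_self, Nat.cast_one]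
      congr 1
    · simp only [Nat.add_sub_cancel, ← add_smul]
      congr 1
      push_cast
      linear_combination h3
  refine Submodule.span_induction (p := fun x _ =>
    e (d x) = d (e x) + (2 * w - L.card : ZMod 3) • x) ?_ (by simp) ?_ ?_ hx
  · rintro _ ⟨l, rfl, rfl, rfl⟩
    clear hx
    induction l with
    | nil => simp [monomial_nil, map_one_eq_zero_of_leibniz hLeib,
        map_one_eq_zero_of_leibniz heLeib]
    | cons p l ih =>
      simp only [monomial_cons, hLeib, heLeib, map_add, ih, hgen]
      simp only [add_mul, mul_add, smul_mul_assoc, mul_smul_comm]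
      simp only [List.map_cons, List.sum_cons, Multiset.coe_card, List.length_cons,
        List.length_map]
      rw [Nat.cast_add, Nat.cast_add]
      module
  · intro x y _ _ hx hy
    simp only [map_add, hx, hy]
    module
  · intro c x _ hx
    simp only [map_smul, hx]
    module

/-- A 3-word with more than one letter is `-d y`, where `y` is homogeneous and annihilated by the
lowering derivation. -/
theorem IsWord3.eq_letter_or_eq_neg_map {e : Gr →ₗ[ZMod 3] Gr}
    (heLeib : ∀ u v : Gr, e (u * v) = e u * v + u * e v)
    (he : ∀ i j : ℕ, e (gen i j) = ((j : ZMod 3) * (j + 1)) • gen i (j - 1))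
    (hLeib : ∀ u v : Gr, d (u * v) = d u * v + u * d v)
    (hd : ∀ i j : ℕ, d (gen i j) = gen i (j + 1)) {x : Gr} {L : Multiset ℕ}
    (hx : IsWord3 g (fun a b c => -d (a * b * c)) x L) :
    (∃ i, x = g i ∧ L = {i}) ∨
      ∃ w y, L.card = 2 * w + 3 ∧ y ∈ homogeneous L w ∧ e y = 0 ∧ x = -d y := by
  have main {x : Gr} {L : Multiset ℕ} (h : (∃ i, x = g i ∧ L = {i}) ∨
      ∃ w y, L.card = 2 * w + 3 ∧ y ∈ homogeneous L w ∧ e y = 0 ∧ x = -d y) :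
      ∃ w, L.card = 2 * w + 1 ∧ x ∈ homogeneous L w ∧ e x = 0 := by
    rcases h with ⟨i, rfl, rfl⟩ | ⟨w, y, hL, hy, hey, rfl⟩
    · exact ⟨0, by simp, gen_mem_homogeneous i 0, by simp [he]⟩
    · refine ⟨w + 1, by omega, neg_mem (map_mem_homogeneous hLeib hd hy), ?_⟩
      have three : (3 : ZMod 3) = 0 := by decide
      have h3 : (2 * w - L.card : ZMod 3) = 0 := by
        rw [hL]
        push_cast
        linear_combination -three
      rw [map_neg, lowering_comm heLeib he hLeib hd hy, hey, h3]
      simp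
  induction hx with
  | letter i => exact .inl ⟨i, rfl, rfl⟩
  | @node u v w L₁ L₂ L₃ _ _ _ ihu ihv ihw =>
    obtain ⟨n₁, hn₁, hu, heu⟩ := main ihu
    obtain ⟨n₂, hn₂, hv, hev⟩ := main ihv
    obtain ⟨n₃, hn₃, hw, hew⟩ := main ihw
    refine .inr ⟨n₁ + n₂ + n₃, u * v * w, ?_, mul_mem_homogeneous (mul_mem_homogeneous hu hv) hw,
      ?_, rfl⟩
    · simp only [Multiset.card_add]
      omega
    · simp [heLeib, heu, hev, hew]

end Derivation

/-- A permutation of the image of a list lifts to a permutation of the list. -/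
theorem List.Perm.exists_map_eq {α β : Type*} {f : α → β} {l : List α} {k : List β}
    (h : (l.map f).Perm k) : ∃ l', l.Perm l' ∧ l'.map f = k := by
  classical
  induction k generalizing l with
  | nil => exact ⟨l, .refl _, h.eq_nil⟩
  | cons b k ih =>
    obtain ⟨a, ha, rfl⟩ := List.mem_map.1 (h.mem_iff.2 List.mem_cons_self)
    have hl := List.perm_cons_erase ha
    obtain ⟨l', hl', rfl⟩ := ih (((hl.map f).symm.trans h).cons_inv)
    exact ⟨a :: l', hl.trans (hl'.cons a), rfl⟩

/-- The monomial in the letters `0, …, 4` and twice `5` and `6` in which the letter `i ≤ 4` has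
order `jᵢ`, the two letters `5` have orders `0` and `p`, and the two letters `6` have orders
`0` and `q`. -/
noncomputable abbrev pairedMonomial (j₀ j₁ j₂ j₃ j₄ p q : ℕ) : Gr :=
  monomial [(0, j₀), (1, j₁), (2, j₂), (3, j₃), (4, j₄), (5, 0), (5, p), (6, 0), (6, q)]

/-- The monomials spanning the component with three derivatives. -/
noncomputable def orderThreeMonomial : Fin 7 → Gr :=
  ![pairedMonomial 1 0 0 0 0 1 1, pairedMonomial 0 1 0 0 0 1 1, pairedMonomial 0 0 1 0 0 1 1,
    pairedMonomial 0 0 0 1 0 1 1, pairedMonomial 0 0 0 0 1 1 1, pairedMonomial 0 0 0 0 0 2 1,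
    pairedMonomial 0 0 0 0 0 1 2]

theorem homogeneous_three_le : homogeneous {0, 1, 2, 3, 4, 5, 5, 6, 6} 3 ≤
    Submodule.span (ZMod 3) (Set.range orderThreeMonomial) := by
  set S := Submodule.span (ZMod 3) (Set.range orderThreeMonomial)
  have hperm {l l' : List (ℕ × ℕ)} (h : l.Perm l') (hl : monomial l' ∈ S) : monomial l ∈ S := by
    rcases monomial_perm h with h | h <;> rw [h]
    exacts [hl, neg_mem hl]
  have hmem (i : Fin 7) : orderThreeMonomial i ∈ S := Submodule.subset_span ⟨i, rfl⟩
  have sorted (j₀ j₁ j₂ j₃ j₄ p p' q q' : ℕ) (hp : p < p') (hq : q < q')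
      (hsum : j₀ + j₁ + j₂ + j₃ + j₄ + p + p' + q + q' = 3) :
      monomial [(0, j₀), (1, j₁), (2, j₂), (3, j₃), (4, j₄), (5, p), (5, p'), (6, q), (6, q')]
        ∈ S := by
    obtain rfl : p = 0 := by omega
    obtain rfl : q = 0 := by omega
    by_cases hp2 : p' = 2
    · obtain ⟨rfl, rfl, rfl, rfl, rfl, rfl, rfl⟩ : j₀ = 0 ∧ j₁ = 0 ∧ j₂ = 0 ∧ j₃ = 0 ∧ j₄ = 0 ∧
        p' = 2 ∧ q' = 1 := by omega
      exact hmem 5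
    by_cases hq2 : q' = 2
    · obtain ⟨rfl, rfl, rfl, rfl, rfl, rfl, rfl⟩ : j₀ = 0 ∧ j₁ = 0 ∧ j₂ = 0 ∧ j₃ = 0 ∧ j₄ = 0 ∧
        p' = 1 ∧ q' = 2 := by omega
      exact hmem 6
    obtain ⟨rfl, rfl⟩ : p' = 1 ∧ q' = 1 := by omega
    obtain ⟨rfl, rfl, rfl, rfl, rfl⟩ | ⟨rfl, rfl, rfl, rfl, rfl⟩ | ⟨rfl, rfl, rfl, rfl, rfl⟩ |
        ⟨rfl, rfl, rfl, rfl, rfl⟩ | ⟨rfl, rfl, rfl, rfl, rfl⟩ :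
        (j₀ = 1 ∧ j₁ = 0 ∧ j₂ = 0 ∧ j₃ = 0 ∧ j₄ = 0) ∨
        (j₀ = 0 ∧ j₁ = 1 ∧ j₂ = 0 ∧ j₃ = 0 ∧ j₄ = 0) ∨
        (j₀ = 0 ∧ j₁ = 0 ∧ j₂ = 1 ∧ j₃ = 0 ∧ j₄ = 0) ∨
        (j₀ = 0 ∧ j₁ = 0 ∧ j₂ = 0 ∧ j₃ = 1 ∧ j₄ = 0) ∨
        (j₀ = 0 ∧ j₁ = 0 ∧ j₂ = 0 ∧ j₃ = 0 ∧ j₄ = 1) := by omega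
    exacts [hmem 0, hmem 1, hmem 2, hmem 3, hmem 4]
  have sortedLeft (j₀ j₁ j₂ j₃ j₄ p p' q q' : ℕ) (hp : p < p')
      (hsum : j₀ + j₁ + j₂ + j₃ + j₄ + p + p' + q + q' = 3) :
      monomial [(0, j₀), (1, j₁), (2, j₂), (3, j₃), (4, j₄), (5, p), (5, p'), (6, q), (6, q')]
        ∈ S := by
    rcases lt_trichotomy q q' with hq | rfl | hq
    · exact sorted _ _ _ _ _ _ _ _ _ hp hq hsum
    · simp only [monomial_cons, gen_mul_gen_mul_self, mul_zero, zero_mem]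
    · refine hperm ?_ (sorted j₀ j₁ j₂ j₃ j₄ p p' q' q hp hq (by omega))
      iterate 7 apply List.Perm.cons
      exact List.Perm.swap _ _ _
  refine Submodule.span_le.2 ?_
  rintro _ ⟨l, hl, hw, rfl⟩
  obtain ⟨l', hll', hl'⟩ := (Multiset.coe_eq_coe.1
    (hl : _ = (([0, 1, 2, 3, 4, 5, 5, 6, 6] : List ℕ) : Multiset ℕ))).exists_map_eq
  refine hperm hll' ?_
  rw [(hll'.map Prod.snd).sum_eq] at hw
  clear hll' hl l
  simp only [List.map_eq_cons_iff, List.map_eq_nil_iff] at hl'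
  obtain ⟨⟨_, j₀⟩, _, rfl, rfl, ⟨_, j₁⟩, _, rfl, rfl, ⟨_, j₂⟩, _, rfl, rfl, ⟨_, j₃⟩, _, rfl, rfl,
    ⟨_, j₄⟩, _, rfl, rfl, ⟨_, p⟩, _, rfl, rfl, ⟨_, p'⟩, _, rfl, rfl, ⟨_, q⟩, _, rfl, rfl,
    ⟨_, q'⟩, _, rfl, rfl, rfl⟩ := hl'
  simp only [List.map_cons, List.map_nil, List.sum_cons, List.sum_nil] at hw
  rcases lt_trichotomy p p' with hp | rfl | hp
  · exact sortedLeft _ _ _ _ _ _ _ _ _ hp (by omega)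
  · simp only [monomial_cons, gen_mul_gen_mul_self, mul_zero, zero_mem]
  · refine hperm ?_ (sortedLeft j₀ j₁ j₂ j₃ j₄ p' p q q' hp (by omega))
    iterate 5 apply List.Perm.cons
    exact List.Perm.swap _ _ _

/-- The elements of the span of `orderThreeMonomial` annihilated by the lowering derivation are
spanned by these. -/
noncomputable def loweredKernel : Fin 6 → Gr :=
  ![pairedMonomial 1 0 0 0 0 1 1 - pairedMonomial 0 0 0 0 1 1 1,
    pairedMonomial 0 1 0 0 0 1 1 - pairedMonomial 0 0 0 0 1 1 1,
    pairedMonomial 0 0 1 0 0 1 1 - pairedMonomial 0 0 0 0 1 1 1,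
    pairedMonomial 0 0 0 1 0 1 1 - pairedMonomial 0 0 0 0 1 1 1,
    pairedMonomial 0 0 0 0 0 2 1, pairedMonomial 0 0 0 0 0 1 2]

theorem mem_span_loweredKernel {e : Gr →ₗ[ZMod 3] Gr}
    (heLeib : ∀ u v : Gr, e (u * v) = e u * v + u * e v)
    (he : ∀ i j : ℕ, e (gen i j) = ((j : ZMod 3) * (j + 1)) • gen i (j - 1)) {y : Gr}
    (hy : y ∈ homogeneous {0, 1, 2, 3, 4, 5, 5, 6, 6} 3) (hey : e y = 0) :
    y ∈ Submodule.span (ZMod 3) (Set.range loweredKernel) := by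
  obtain ⟨c, rfl⟩ := (Submodule.mem_span_range_iff_exists_fun _).1 (homogeneous_three_le hy)
  have three : (3 : ZMod 3) = 0 := by decide
  have e_one : e 1 = 0 := map_one_eq_zero_of_leibniz heLeib
  have e_zero (i : ℕ) : e (gen i 0) = 0 := by simp [he]
  have e_first (i : ℕ) : e (gen i 1) = (2 : ZMod 3) • gen i 0 := by
    rw [he]
    rfl
  have e_second (i : ℕ) : e (gen i 2) = 0 := by
    rw [he, show (((2 : ℕ) : ZMod 3) * ((2 : ℕ) + 1)) = 0 from rfl, zero_smul]
  have hsum : (c 0 + c 1 + c 2 + c 3 + c 4) • pairedMonomial 0 0 0 0 0 1 1 = 0 := by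
    rw [← neg_eq_zero, ← hey]
    simp only [Fin.sum_univ_seven, orderThreeMonomial, Matrix.cons_val, map_add, map_smul,
      monomial_cons, monomial_nil, heLeib, e_one, e_zero, e_first, e_second, mul_zero, zero_mul,
      add_zero, zero_add, smul_zero, mul_smul_comm, smul_mul_assoc, gen_mul_gen_mul_self]
    match_scalars
    linear_combination -(c 0 + c 1 + c 2 + c 3 + c 4) * three
  have hc : c 0 + c 1 + c 2 + c 3 + c 4 = 0 :=
    (smul_eq_zero.1 hsum).resolve_right (monomial_ne_zero (by decide))
  rw [Submodule.mem_span_range_iff_exists_fun]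
  refine ⟨![c 0, c 1, c 2, c 3, c 5, c 6], ?_⟩
  simp only [Fin.sum_univ_six, Fin.sum_univ_seven, orderThreeMonomial, loweredKernel,
    Matrix.cons_val]
  rw [show c 4 = -(c 0 + c 1 + c 2 + c 3) by linear_combination hc]
  module

/-- The algebra endomorphism killing the generators outside `s`. -/
theorem exists_projection (s : List (ℕ × ℕ)) :
    ∃ π : Gr →ₐ[ZMod 3] Gr, ∀ i j, π (gen i j) = if (i, j) ∈ s then gen i j else 0 := by
  refine ⟨ExteriorAlgebra.map (Finsupp.linearCombination (ZMod 3)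
    fun p => if p ∈ s then Finsupp.single p 1 else 0), fun i j => ?_⟩
  rw [ExteriorAlgebra.map_apply_ι, Finsupp.linearCombination_single, one_smul]
  split_ifs <;> simp

theorem linearIndependent_map_loweredKernel {d : Gr →ₗ[ZMod 3] Gr}
    (hLeib : ∀ u v : Gr, d (u * v) = d u * v + u * d v)
    (hd : ∀ i j : ℕ, d (gen i j) = gen i (j + 1)) :
    LinearIndependent (ZMod 3) (d ∘ loweredKernel) := by
  have d_one : d 1 = 0 := map_one_eq_zero_of_leibniz hLeib
  rw [Fintype.linearIndependent_iff]
  intro c hc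
  have coeff (i : Fin 6) (s : List (ℕ × ℕ)) (hs : s.Nodup)
      (h : ∀ π : Gr →ₐ[ZMod 3] Gr,
        (∀ i j, π (gen i j) = if (i, j) ∈ s then gen i j else 0) →
        π (∑ k, c k • (d ∘ loweredKernel) k) = c i • monomial s) : c i = 0 := by
    obtain ⟨π, hπ⟩ := exists_projection s
    have := h π hπ
    rw [hc, map_zero] at this
    exact (smul_eq_zero.1 this.symm).resolve_right (monomial_ne_zero hs)
  intro i
  fin_cases i
  on_goal 1 =>
    refine coeff 0 [(0, 2), (1, 0), (2, 0), (3, 0), (4, 0), (5, 0), (5, 1), (6, 0), (6, 1)]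
      (by decide) ?_
  on_goal 2 =>
    refine coeff 1 [(0, 0), (1, 2), (2, 0), (3, 0), (4, 0), (5, 0), (5, 1), (6, 0), (6, 1)]
      (by decide) ?_
  on_goal 3 =>
    refine coeff 2 [(0, 0), (1, 0), (2, 2), (3, 0), (4, 0), (5, 0), (5, 1), (6, 0), (6, 1)]
      (by decide) ?_
  on_goal 4 =>
    refine coeff 3 [(0, 0), (1, 0), (2, 0), (3, 2), (4, 0), (5, 0), (5, 1), (6, 0), (6, 1)]
      (by decide) ?_
  on_goal 5 =>
    refine coeff 4 [(0, 0), (1, 0), (2, 0), (3, 0), (4, 0), (5, 1), (5, 2), (6, 0), (6, 1)]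
      (by decide) ?_
  on_goal 6 =>
    refine coeff 5 [(0, 0), (1, 0), (2, 0), (3, 0), (4, 0), (5, 0), (5, 1), (6, 1), (6, 2)]
      (by decide) ?_
  all_goals
    intro π hπ
    simp only [Fin.sum_univ_six, Function.comp_apply, loweredKernel, Matrix.cons_val, map_sub,
      map_add, map_smul, map_mul, monomial_cons, monomial_nil, hLeib, hd, d_one, hπ]
    simp

theorem gen_mul_gen_swap_of_lt {i j k l : ℕ} (_ : k < i ∨ k = i ∧ l < j) :
    gen i j * gen k l = -(gen k l * gen i j) :=
  gen_mul_gen_swap i j k l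

theorem gen_mul_gen_mul_swap_of_lt {i j k l : ℕ} (_ : k < i ∨ k = i ∧ l < j) (x : Gr) :
    gen i j * (gen k l * x) = -(gen k l * (gen i j * x)) :=
  gen_mul_gen_mul_swap i j k l x

theorem map_loweredKernel_mem_span {d : Gr →ₗ[ZMod 3] Gr}
    (hLeib : ∀ u v : Gr, d (u * v) = d u * v + u * d v)
    (hd : ∀ i j : ℕ, d (gen i j) = gen i (j + 1)) (i : Fin 6) :
    d (loweredKernel i) ∈ Submodule.span (ZMod 3)
      {x : Gr | IsWord3 g (fun a b c => -d (a * b * c)) x {0, 1, 2, 3, 4, 5, 5, 6, 6}} := by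
  set S := Submodule.span (ZMod 3)
    {x : Gr | IsWord3 g (fun a b c => -d (a * b * c)) x {0, 1, 2, 3, 4, 5, 5, 6, 6}}
  have letter (i : ℕ) : IsWord3 g (fun a b c => -d (a * b * c)) (g i) {i} := .letter i
  have mem {u v w : Gr} {L₁ L₂ L₃ : Multiset ℕ}
      (hu : IsWord3 g (fun a b c => -d (a * b * c)) u L₁)
      (hv : IsWord3 g (fun a b c => -d (a * b * c)) v L₂)
      (hw : IsWord3 g (fun a b c => -d (a * b * c)) w L₃)
      (hL : L₁ + L₂ + L₃ = {0, 1, 2, 3, 4, 5, 5, 6, 6}) : u * v * w ∈ S.comap d := by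
    rw [Submodule.mem_comap, ← neg_mem_iff]
    exact Submodule.subset_span (hL ▸ hu.node hv hw)
  have triple (i j k l m : ℕ) (hL : ({5} + {6} + {i} + ({5} + {6} + {j}) + ({k} + {l} + {m}) :
      Multiset ℕ) = {0, 1, 2, 3, 4, 5, 5, 6, 6}) :=
    mem (((letter 5).node (letter 6) (letter i))) ((letter 5).node (letter 6) (letter j))
      ((letter k).node (letter l) (letter m)) hL
  have nested (p q : ℕ) (hL : ({1} + ({p} + {q} + {2}) + ({p} + {3} + ({q} + {0} + {4})) :
      Multiset ℕ) = {0, 1, 2, 3, 4, 5, 5, 6, 6}) :=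
    mem (letter 1) ((letter p).node (letter q) (letter 2))
      ((letter p).node (letter 3) ((letter q).node (letter 0) (letter 4))) hL
  have neg_add_neg_self (x : Gr) : -x + -x = x := by
    have h : (3 : ZMod 3) • x = 0 := by
      rw [show (3 : ZMod 3) = 0 from rfl, zero_smul]
    rw [← sub_eq_zero, ← neg_eq_zero, ← h]
    module
  have h012 := triple 3 4 0 1 2 (by decide)
  have h124 := triple 0 3 1 2 4 (by decide)
  have h024 := triple 3 1 0 2 4 (by decide)
  have h014 := triple 2 3 0 1 4 (by decide)
  have h123 := triple 4 0 1 2 3 (by decide)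
  have hP := nested 6 5 (by decide)
  have hQ := nested 5 6 (by decide)
  simp only [g, hLeib, hd, add_mul, mul_add, neg_mul, mul_neg, neg_neg, neg_add, mul_assoc,
    gen_mul_gen_self, gen_mul_gen_mul_self, gen_mul_gen_swap_of_lt, gen_mul_gen_mul_swap_of_lt,
    mul_zero, neg_zero, add_zero, zero_add, map_add, map_neg, neg_add_neg_self, Nat.reduceAdd,
    Nat.reduceLT, Nat.reduceEqDiff, true_or, false_or, true_and, zero_lt_one]
    at h012 h124 h024 h014 h123 hP hQ
  rw [← Submodule.mem_comap]
  fin_cases i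
  on_goal 1 => have h := sub_mem h012 h124
  on_goal 2 => have h := sub_mem h012 h024
  on_goal 3 => have h := sub_mem h012 h014
  on_goal 4 => have h := sub_mem h123 h124
  on_goal 5 => have h := sub_mem (sub_mem (sub_mem h012 h014) (sub_mem h123 h124)) hP
  on_goal 6 => have h := sub_mem (sub_mem (sub_mem h012 h014) (sub_mem h123 h124)) hQ
  all_goals
    convert h using 1
    simp [loweredKernel, monomial_cons, monomial_nil]
    try abel

/-- the `𝔽₃`-span of all 3-words in the letters g₀,…,g₄ (once each) and g₅,g₆ (twice each)
has dimension `6`. -/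
theorem stmt_9 (d : Gr →ₗ[ZMod 3] Gr)
    (hLeib : ∀ u v : Gr, d (u * v) = d u * v + u * d v)
    (hd : ∀ i j : ℕ, d (gen i j) = gen i (j + 1)) :
    Module.finrank (ZMod 3)
      ↥(Submodule.span (ZMod 3)
        {x : Gr | IsWord3 g (fun a b c => -d (a * b * c)) x (({0, 1, 2, 3, 4, 5, 5, 6, 6} : Multiset ℕ))}) = 6 := by
  obtain ⟨e, heLeib, heι⟩ := ExteriorAlgebra.exists_derivation_extending
    (Finsupp.linearCombination (ZMod 3) fun p : ℕ × ℕ =>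
      ((p.2 : ZMod 3) * (p.2 + 1)) • Finsupp.single (p.1, p.2 - 1) (1 : ZMod 3))
  have he (i j : ℕ) : e (gen i j) = ((j : ZMod 3) * (j + 1)) • gen i (j - 1) := by
    rw [heι, Finsupp.linearCombination_single, one_smul, map_smul]
  have hspan : Submodule.span (ZMod 3)
      {x : Gr | IsWord3 g (fun a b c => -d (a * b * c)) x {0, 1, 2, 3, 4, 5, 5, 6, 6}} =
      Submodule.span (ZMod 3) (Set.range (d ∘ loweredKernel)) := by
    refine le_antisymm (Submodule.span_le.2 fun x hx => ?_) (Submodule.span_le.2 ?_)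
    · rcases IsWord3.eq_letter_or_eq_neg_map heLeib he hLeib hd hx with
        ⟨i, -, hL⟩ | ⟨w, y, hw, hy, hey, rfl⟩
      · simpa using congrArg Multiset.card hL
      · obtain rfl : w = 3 := by
          simp only [Multiset.insert_eq_cons, Multiset.card_cons, Multiset.card_singleton] at hw
          omega
        rw [SetLike.mem_coe, neg_mem_iff, Set.range_comp, ← Submodule.map_span]
        exact Submodule.mem_map_of_mem (mem_span_loweredKernel heLeib he hy hey)
    · rintro _ ⟨i, rfl⟩
      exact map_loweredKernel_mem_span hLeib hd i
  rw [hspan, finrank_span_eq_card (linearIndependent_map_loweredKernel hLeib hd), Fintype.card_fin]
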